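/- ((p,q)-Taylor formula, first form.) Let K be a field and p, q nonzero elements of K with p^j ≠ q^j for 1 ≤ j ≤ N, and let a ∈ K. Then every polynomial f ∈ K[X] of degree at most N satisfies the identity f = Σ_{k=0}^{N} p^{−k(k−1)/2} · ((D_{p,q}^k f)(a p^{−k}) / [k]!_{p,q}) · (X ⊖ a)^k_{p,q} in K[X], where (D_{p,q}^k f)(a p^{−k}) denotes the evaluation of the polynomial D_{p,q}^k f at the point a p^{−k}. -/

import Mathlib

open Polynomial

/-- The `(p,q)`-number `[n]_{p,q} = (pⁿ − qⁿ)/(p − q)`. -/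
noncomputable def pqNum {K : Type*} [Field K] (p q : K) (n : ℕ) : K :=
  (p ^ n - q ^ n) / (p - q)

/-- The `(p,q)`-factorial `[n]!_{p,q} = ∏_{j=1}^{n} [j]_{p,q}`. -/
noncomputable def pqFactorial {K : Type*} [Field K] (p q : K) (n : ℕ) : K :=
  ∏ j ∈ Finset.range n, pqNum p q (j + 1)

/-- The `(p,q)`-derivative on `K[X]`: the `K`-linear operation with
`D_{p,q}(Xⁿ) = [n]_{p,q} X^{n−1}` and `D_{p,q}(1) = 0`; equivalently, for `z ≠ 0`,
`(D_{p,q}f)(z) = (f(pz) − f(qz))/((p − q)z)`. -/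
noncomputable def pqDeriv {K : Type*} [Field K] (p q : K) (f : Polynomial K) : Polynomial K :=
  Polynomial.C (p - q)⁻¹ * (f.comp (Polynomial.C p * Polynomial.X) -
    f.comp (Polynomial.C q * Polynomial.X)).divX

theorem coeff_pqDeriv {K : Type*} [Field K] (p q : K) (f : Polynomial K) (n : ℕ) :
    (pqDeriv p q f).coeff n = pqNum p q (n + 1) * f.coeff (n + 1) := by
  simp only [pqDeriv, pqNum, coeff_C_mul, coeff_divX, coeff_sub, comp_C_mul_X_coeff]
  ring

theorem pqDeriv_sub {K : Type*} [Field K] (p q : K) (f g : Polynomial K) :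
    pqDeriv p q (f - g) = pqDeriv p q f - pqDeriv p q g := by
  ext n
  simp only [coeff_pqDeriv, coeff_sub, mul_sub]

theorem pqDeriv_C {K : Type*} [Field K] (p q c : K) : pqDeriv p q (C c) = 0 := by
  ext n
  simp [coeff_pqDeriv]

theorem pqDeriv_add {K : Type*} [Field K] (p q : K) (f g : Polynomial K) :
    pqDeriv p q (f + g) = pqDeriv p q f + pqDeriv p q g := by
  ext n
  simp only [coeff_pqDeriv, coeff_add, mul_add]

theorem pqDeriv_C_mul {K : Type*} [Field K] (p q c : K) (f : Polynomial K) :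
    pqDeriv p q (C c * f) = C c * pqDeriv p q f := by
  ext n
  simp only [coeff_pqDeriv, coeff_C_mul]
  ring

theorem pqDeriv_sum {K : Type*} [Field K] (p q : K) {ι : Type*} (s : Finset ι)
    (f : ι → Polynomial K) :
    pqDeriv p q (∑ i ∈ s, f i) = ∑ i ∈ s, pqDeriv p q (f i) := by
  ext n
  simp only [coeff_pqDeriv, finsetSum_coeff, Finset.mul_sum]

theorem natDegree_pqDeriv_le {K : Type*} [Field K] (p q : K) {f : Polynomial K} {N : ℕ}
    (hf : f.natDegree ≤ N + 1) : (pqDeriv p q f).natDegree ≤ N := by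
  refine natDegree_le_iff_coeff_eq_zero.mpr fun n hn => ?_
  rw [coeff_pqDeriv, coeff_eq_zero_of_natDegree_lt (by omega), mul_zero]

/-- The `(p,q)`-derivative lowers the `(p,q)`-power basis, moving the base point to `a / p`. -/
theorem pqDeriv_pqPow_succ {K : Type*} [Field K] {p : K} (q : K) (hp : p ≠ 0) (a : K) (k : ℕ) :
    pqDeriv p q (∏ i ∈ Finset.range (k + 1), (C (p ^ i) * X - C (q ^ i * a))) =
      C (pqNum p q (k + 1) * p ^ k) *
        ∏ i ∈ Finset.range k, (C (p ^ i) * X - C (q ^ i * (a / p))) := by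
  set Q : Polynomial K := ∏ i ∈ Finset.range k, (C (p ^ i) * X - C (q ^ i * (a / p))) with hQ
  have hpQ : (∏ i ∈ Finset.range k, (C (p ^ (i + 1)) * X - C (q ^ i * a))) = C (p ^ k) * Q := by
    have hpk : C (p ^ k) = ∏ i ∈ Finset.range k, C p := by simp
    rw [hQ, hpk, ← Finset.prod_mul_distrib]
    refine Finset.prod_congr rfl fun i _ => ?_
    rw [mul_sub, ← mul_assoc, ← C_mul, ← C_mul, ← pow_succ']
    congr 2
    field_simp
  have h₁ : (∏ i ∈ Finset.range (k + 1), (C (p ^ i) * X - C (q ^ i * a))).comp (C p * X) =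
      C (p ^ k) * Q * (C (p ^ (k + 1)) * X - C (q ^ k * a)) := by
    rw [← hpQ, ← Finset.prod_range_succ (fun i => C (p ^ (i + 1)) * X - C (q ^ i * a)),
      prod_comp]
    refine Finset.prod_congr rfl fun i _ => ?_
    simp
    ring
  have h₂ : (∏ i ∈ Finset.range (k + 1), (C (p ^ i) * X - C (q ^ i * a))).comp (C q * X) =
      C (q ^ k) * (C (p ^ k) * Q) * (C q * X - C a) := by
    have hqk : C (q ^ k) = ∏ i ∈ Finset.range k, C q := by simp
    rw [← hpQ, hqk, Finset.prod_range_succ', mul_comp, prod_comp, ← Finset.prod_mul_distrib]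
    congr 1
    · refine Finset.prod_congr rfl fun i _ => ?_
      simp
      ring
    · simp
  have h₃ : C (p ^ k) * Q * (C (p ^ (k + 1)) * X - C (q ^ k * a)) -
      C (q ^ k) * (C (p ^ k) * Q) * (C q * X - C a) =
      C ((p ^ (k + 1) - q ^ (k + 1)) * p ^ k) * Q * X := by
    simp only [C_mul, C_sub, C_pow]
    ring
  have h₄ (g : Polynomial K) : (g * X).divX = g := by
    ext n
    rw [coeff_divX, coeff_mul_X]
  rw [pqDeriv, h₁, h₂, h₃, h₄, pqNum, ← mul_assoc, ← C_mul]
  congr 2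
  ring

theorem eq_C_of_pqDeriv_eq_zero {K : Type*} [Field K] {p q : K} {N : ℕ}
    (hpq : ∀ j : ℕ, 1 ≤ j → j ≤ N → p ^ j ≠ q ^ j) {f : Polynomial K}
    (hf : f.natDegree ≤ N) (h : pqDeriv p q f = 0) : f = C (f.coeff 0) := by
  ext n
  rcases n with _ | n
  · simp
  rw [coeff_C_succ]
  by_cases hn : n + 1 ≤ N
  · have h0 : pqNum p q (n + 1) * f.coeff (n + 1) = 0 := by rw [← coeff_pqDeriv, h, coeff_zero]
    refine (mul_eq_zero.mp h0).resolve_left ?_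
    refine div_ne_zero (sub_ne_zero.mpr (hpq _ (by omega) hn)) (sub_ne_zero.mpr ?_)
    simpa using hpq 1 le_rfl (by omega)
  · exact coeff_eq_zero_of_natDegree_lt (by omega)

theorem natDegree_pqPow_le {K : Type*} [Field K] (p q a : K) (k : ℕ) :
    (∏ i ∈ Finset.range k, (C (p ^ i) * X - C (q ^ i * a))).natDegree ≤ k := by
  refine (natDegree_prod_le _ _).trans ?_
  refine (Finset.sum_le_card_nsmul _ _ 1 fun i _ => ?_).trans (by simp)
  compute_degree

theorem eval_pqPow_succ_self {K : Type*} [Field K] (p q a : K) (k : ℕ) :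
    (∏ i ∈ Finset.range (k + 1), (C (p ^ i) * X - C (q ^ i * a))).eval a = 0 := by
  simp [Finset.prod_range_succ']

/-- The `(p,q)`-Taylor formula, first form: every polynomial `f` of degree at most `N`
satisfies `f = Σ_{k=0}^{N} p^{−k(k−1)/2} ((D_{p,q}^k f)(a p^{−k}) / [k]!_{p,q}) (X ⊖ a)^k_{p,q}`,
where `(x ⊖ a)^k_{p,q} = ∏_{i=0}^{k−1} (pⁱ x − qⁱ a)`. -/
theorem pq_taylor_formula_first_form
    (K : Type*) [Field K] (p q : K) (hp : p ≠ 0) (hq : q ≠ 0) (N : ℕ)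
    (hpq : ∀ j : ℕ, 1 ≤ j → j ≤ N → p ^ j ≠ q ^ j) (a : K)
    (f : Polynomial K) (hf : f.natDegree ≤ N) :
    f = ∑ k ∈ Finset.range (N + 1),
        C ((p ^ (k * (k - 1) / 2))⁻¹ *
            (((pqDeriv p q)^[k] f).eval (a / p ^ k) / pqFactorial p q k)) *
          ∏ i ∈ Finset.range k, (C (p ^ i) * X - C (q ^ i * a)) := by
  induction N generalizing f a with
  | zero =>
    rw [eq_C_of_natDegree_le_zero hf]
    simp [pqFactorial]
  | succ N ih =>
    set T : Polynomial K := ∑ k ∈ Finset.range (N + 1 + 1),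
        C ((p ^ (k * (k - 1) / 2))⁻¹ *
            (((pqDeriv p q)^[k] f).eval (a / p ^ k) / pqFactorial p q k)) *
          ∏ i ∈ Finset.range k, (C (p ^ i) * X - C (q ^ i * a)) with hT
    have hp_sub : p - q ≠ 0 := by
      simpa using sub_ne_zero.mpr (hpq 1 le_rfl (by omega))
    have hderiv : pqDeriv p q T = pqDeriv p q f := by
      rw [ih (fun j h₁ h₂ => hpq j h₁ (by omega)) (a / p) (pqDeriv p q f)
        (natDegree_pqDeriv_le p q hf), hT, Finset.sum_range_succ', pqDeriv_add, pqDeriv_sum]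
      rw [Finset.prod_range_zero, mul_one, pqDeriv_C, add_zero]
      refine Finset.sum_congr rfl fun k hk => ?_
      rw [Finset.mem_range] at hk
      rw [pqDeriv_C_mul, pqDeriv_pqPow_succ q hp, ← mul_assoc, ← C_mul, Function.iterate_succ_apply]
      have htri : (k + 1) * (k + 1 - 1) / 2 = k * (k - 1) / 2 + k := by
        rw [← Finset.sum_range_id_mul_two, ← Finset.sum_range_id_mul_two,
          Nat.mul_div_cancel _ two_pos, Nat.mul_div_cancel _ two_pos, Finset.sum_range_succ]
      have hnum : pqNum p q (k + 1) ≠ 0 :=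
        div_ne_zero (sub_ne_zero.mpr (hpq _ (by omega) (by omega))) hp_sub
      have hfac : pqFactorial p q (k + 1) = pqFactorial p q k * pqNum p q (k + 1) :=
        Finset.prod_range_succ _ _
      have hpt : a / p ^ (k + 1) = a / p / p ^ k := by
        rw [div_div, pow_succ']
      rw [htri, hfac, hpt]
      congr 2
      rw [pow_add]
      field_simp
    have hdeg : T.natDegree ≤ N + 1 := by
      refine natDegree_sum_le_of_forall_le _ _ fun k hk => ?_
      rw [Finset.mem_range] at hk
      exact (natDegree_C_mul_le _ _).trans ((natDegree_pqPow_le p q a k).trans (by omega))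
    have heval : T.eval a = f.eval a := by
      rw [hT, Finset.sum_range_succ', eval_add, eval_finsetSum,
        Finset.sum_eq_zero fun k _ => by rw [eval_mul, eval_pqPow_succ_self, mul_zero]]
      simp [pqFactorial]
    have hsub : (f - T).natDegree ≤ N + 1 :=
      (natDegree_sub_le f T).trans (max_le hf hdeg)
    have hconst := eq_C_of_pqDeriv_eq_zero hpq hsub (by rw [pqDeriv_sub, hderiv, sub_self])
    have hzero : (f - T).coeff 0 = 0 := by
      have := congrArg (eval a) hconst
      rwa [eval_sub, heval, sub_self, eval_C, eq_comm] at this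
    rwa [hzero, C_0, sub_eq_zero] at hconst
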